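/- Fix a positive integer K, a set H, a colouring c assigning to every unordered pair of distinct elements of H a colour in {0,…,K−1}, a stationary set Λ ⊆ P_{ω1}(H), and a function F : Λ → H such that F(M) ∉ M for every M ∈ Λ. Then there exist a fine normal ideal I on P_{ω1}(H), a set A ⊆ Λ with A ∈ I⁺, and i, j < K such that: for every fine normal ideal J ⊇ I and every B ⊆ A with B ∈ J⁺, there are S, T ⊆ B with S, T ∈ J⁺ such that (S,T) is (i,j)-saturated over I. -/

import Mathlib

namespace Galvin

/-- `P_{ω₁}(H)`: the collection of countable subsets of `H`. -/
def Pom (H : Type u) : Set (Set H) := {M : Set H | M.Countable}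

/-- An ideal on `P_{ω₁}(H)`: a proper collection of subsets of `P_{ω₁}(H)` closed under
subsets and finite unions. -/
structure IsIdeal (H : Type u) (I : Set (Set (Set H))) : Prop where
  subset_pom : ∀ A ∈ I, A ⊆ Pom H
  empty_mem : (∅ : Set (Set H)) ∈ I
  subset_mem : ∀ A ∈ I, ∀ B : Set (Set H), B ⊆ A → B ∈ I
  union_mem : ∀ A ∈ I, ∀ B ∈ I, A ∪ B ∈ I
  proper : Pom H ∉ I

/-- ℵ₁-completeness: closure under countable unions. -/
def IsComplete {H : Type u} (I : Set (Set (Set H))) : Prop :=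
  ∀ A : ℕ → Set (Set H), (∀ n, A n ∈ I) → (⋃ n, A n) ∈ I

/-- A fine ideal: an ℵ₁-complete ideal containing `{M : x ∉ M}` for every `x ∈ H`. -/
def IsFineIdeal (H : Type u) (I : Set (Set (Set H))) : Prop :=
  IsIdeal H I ∧ IsComplete I ∧ ∀ x : H, {M ∈ Pom H | x ∉ M} ∈ I

/-- Normality: closure under diagonal unions. -/
def IsNormal (H : Type u) (I : Set (Set (Set H))) : Prop :=
  ∀ A : H → Set (Set H), (∀ x, A x ∈ I) → {M ∈ Pom H | ∃ x ∈ M, M ∈ A x} ∈ I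

/-- `I⁺`: the `I`-positive subsets of `P_{ω₁}(H)`. -/
def pos (H : Type u) (I : Set (Set (Set H))) : Set (Set (Set H)) :=
  {A | A ⊆ Pom H ∧ A ∉ I}

/-- `I*`: the dual filter of `I`. -/
def star (H : Type u) (I : Set (Set (Set H))) : Set (Set (Set H)) :=
  {A | Pom H \ A ∈ I}

/-- `I + A`: the ideal `{B : B ∩ A ∈ I}`. -/
def add (H : Type u) (I : Set (Set (Set H))) (A : Set (Set H)) : Set (Set (Set H)) :=
  {B | B ⊆ Pom H ∧ B ∩ A ∈ I}

end Galvin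
namespace Galvin

/-- `∃^I M ∈ A, φ(M)`: the set of `M ∈ A` with `φ(M)` is `(I+A)`-positive. -/
def eIdeal {H : Type u} (I : Set (Set (Set H))) (A : Set (Set H)) (φ : Set H → Prop) : Prop :=
  {M ∈ A | φ M} ∈ pos H (add H I A)

/-- `∀^I M ∈ A, φ(M)`: the set of `M ∈ A` with `φ(M)` is in the dual filter `(I+A)*`. -/
def aIdeal {H : Type u} (I : Set (Set (Set H))) (A : Set (Set H)) (φ : Set H → Prop) : Prop :=
  {M ∈ A | φ M} ∈ star H (add H I A)

/-- `(A, B)` is weakly `(i,j)`-saturated over `I`. -/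
def WeaklySat {H : Type u} {X : Type v} {K : ℕ} (c : Sym2 X → Fin K)
    (I : Set (Set (Set H))) (F : Set H → X) (A B : Set (Set H)) (i j : Fin K) : Prop :=
  eIdeal I A (fun M => eIdeal I B (fun N => F M ≠ F N ∧ c s(F M, F N) = i)) ∧
  eIdeal I B (fun N => eIdeal I A (fun M => F M ≠ F N ∧ c s(F M, F N) = j))

/-- `(A, B)` is `(i,j)`-saturated over `I`: every pair of `I`-positive subsets is weakly
`(i,j)`-saturated over `I`. -/
def Sat {H : Type u} {X : Type v} {K : ℕ} (c : Sym2 X → Fin K)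
    (I : Set (Set (Set H))) (F : Set H → X) (A B : Set (Set H)) (i j : Fin K) : Prop :=
  ∀ C, C ⊆ A → C ∈ pos H I → ∀ D, D ⊆ B → D ∈ pos H I → WeaklySat c I F C D i j

/-- `(A, B)` is `P`-unsaturated over `I`: for no `(i,j) ∈ P` is `(A,B)` weakly
`(i,j)`-saturated over `I`. -/
def Unsat {H : Type u} {X : Type v} {K : ℕ} (c : Sym2 X → Fin K)
    (I : Set (Set (Set H))) (F : Set H → X) (A B : Set (Set H))
    (P : Set (Fin K × Fin K)) : Prop :=
  ∀ p ∈ P, ¬ WeaklySat c I F A B p.1 p.2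

end Galvin
namespace Galvin

/-- A club in `P_{ω₁}(H)`: a cofinal collection of countable subsets of `H` closed under
unions of nonempty countable `⊆`-chains. -/
def IsClub (H : Type u) (C : Set (Set H)) : Prop :=
  C ⊆ Pom H ∧ (∀ N ∈ Pom H, ∃ M ∈ C, N ⊆ M) ∧
    ∀ D : Set (Set H), D ⊆ C → D.Nonempty → D.Countable → IsChain (· ⊆ ·) D → ⋃₀ D ∈ C

/-- A stationary subset of `P_{ω₁}(H)`: one meeting every club. -/
def IsStationary (H : Type u) (S : Set (Set H)) : Prop :=
  S ⊆ Pom H ∧ ∀ C : Set (Set H), IsClub H C → (S ∩ C).Nonempty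

end Galvin

namespace Galvin

/-- The countable sets closed under a set-valued operation on finite sequences. -/
def closedSets {H : Type*} (f : List H → Set H) : Set (Set H) :=
  {M ∈ Pom H | ∀ l : List H, (∀ x ∈ l, x ∈ M) → f l ⊆ M}

/-- The nonstationary ideal on `P_{ω₁}(H)`, presented through countable-valued operations. -/
def nonstationary (H : Type*) : Set (Set (Set H)) :=
  {A | A ⊆ Pom H ∧ ∃ f : List H → Set H, (∀ l, (f l).Countable) ∧ Disjoint A (closedSets f)}

lemma countable_setOf_list_subset {H : Type*} {N : Set H} (hN : N.Countable) :
    {l : List H | ∀ x ∈ l, x ∈ N}.Countable := by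
  have : Countable N := hN
  refine (Set.countable_range (fun l : List N => l.map Subtype.val)).mono fun l hl => ?_
  exact ⟨l.attachWith (· ∈ N) hl, by simp⟩

lemma exists_closedSets_superset {H : Type*} {f : List H → Set H} (hf : ∀ l, (f l).Countable)
    {N : Set H} (hN : N ∈ Pom H) : ∃ M ∈ closedSets f, N ⊆ M := by
  let step : Set H → Set H := fun M => M ∪ ⋃ l ∈ {l : List H | ∀ x ∈ l, x ∈ M}, f l
  let stage : ℕ → Set H := fun n => step^[n] N
  have succ (n : ℕ) : stage (n + 1) = step (stage n) := Function.iterate_succ_apply' _ _ _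
  have mono : Monotone stage :=
    monotone_nat_of_le_succ fun n => by rw [succ]; exact Set.subset_union_left
  have countable (n : ℕ) : (stage n).Countable := by
    induction n with
    | zero => exact hN
    | succ n ih =>
      rw [succ]
      exact ih.union ((countable_setOf_list_subset ih).biUnion fun l _ => hf l)
  refine ⟨⋃ n, stage n, ⟨Set.countable_iUnion countable, fun l hl => ?_⟩,
    Set.subset_iUnion stage 0⟩
  obtain ⟨n, hn⟩ : ∃ n, ∀ x ∈ l, x ∈ stage n := by
    induction l with
    | nil => exact ⟨0, by simp⟩
    | cons a l ih =>
      obtain ⟨n, hn⟩ := ih fun x hx => hl x (List.mem_cons_of_mem _ hx)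
      obtain ⟨m, hm⟩ := Set.mem_iUnion.1 (hl a List.mem_cons_self)
      refine ⟨max n m, fun x hx => ?_⟩
      rcases List.mem_cons.1 hx with rfl | hx
      · exact mono (le_max_right n m) hm
      · exact mono (le_max_left n m) (hn x hx)
  refine subset_trans ?_ (Set.subset_iUnion stage (n + 1))
  rw [succ]
  exact (Set.subset_biUnion_of_mem (u := f)
    (show l ∈ {l : List H | ∀ x ∈ l, x ∈ stage n} from hn)).trans
    Set.subset_union_right

lemma isClub_closedSets {H : Type*} {f : List H → Set H} (hf : ∀ l, (f l).Countable) :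
    IsClub H (closedSets f) := by
  refine ⟨fun M hM => hM.1, fun N hN => exists_closedSets_superset hf hN,
    fun D hD hne hcount hchain => ⟨hcount.sUnion fun M hM => (hD hM).1, fun l hl => ?_⟩⟩
  obtain ⟨M, hM, hlM⟩ : ∃ M ∈ D, ∀ x ∈ l, x ∈ M := by
    induction l with
    | nil => exact hne.imp fun M hM => ⟨hM, by simp⟩
    | cons a l ih =>
      obtain ⟨M, hM, hlM⟩ := ih fun x hx => hl x (List.mem_cons_of_mem _ hx)
      obtain ⟨N, hN, haN⟩ := hl a List.mem_cons_self
      rcases hchain.total hM hN with h | h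
      · exact ⟨N, hN, List.forall_mem_cons.2 ⟨haN, fun x hx => h (hlM x hx)⟩⟩
      · exact ⟨M, hM, List.forall_mem_cons.2 ⟨h haN, hlM⟩⟩
  exact ((hD hM).2 l hlM).trans (Set.subset_sUnion_of_mem hM)

lemma IsStationary.mem_pos_nonstationary {H : Type*} {S : Set (Set H)} (hS : IsStationary H S) :
    S ∈ pos H (nonstationary H) := by
  refine ⟨hS.1, ?_⟩
  rintro ⟨-, f, hf, hdisj⟩
  exact Set.not_disjoint_iff_nonempty_inter.2 (hS.2 _ (isClub_closedSets hf)) hdisj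

lemma isComplete_nonstationary (H : Type*) : IsComplete (nonstationary H) := by
  intro A hA
  choose hsub f hf hdisj using hA
  refine ⟨Set.iUnion_subset hsub, fun l => ⋃ n, f n l,
    fun l => Set.countable_iUnion fun n => hf n l, Set.disjoint_left.2 ?_⟩
  rintro M hM ⟨hMc, hMf⟩
  obtain ⟨n, hn⟩ := Set.mem_iUnion.1 hM
  exact Set.disjoint_left.1 (hdisj n) hn
    ⟨hMc, fun l hl => (Set.subset_iUnion (fun n => f n l) n).trans (hMf l hl)⟩

lemma isFineIdeal_nonstationary (H : Type*) : IsFineIdeal H (nonstationary H) := by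
  have hcomplete := isComplete_nonstationary H
  refine ⟨⟨fun A hA => hA.1, ?_, ?_, ?_, ?_⟩, hcomplete, fun x => ?_⟩
  · exact ⟨Set.empty_subset _, fun _ => ∅, fun _ => Set.countable_empty, Set.empty_disjoint _⟩
  · rintro A ⟨hA, f, hf, hdisj⟩ B hB
    exact ⟨hB.trans hA, f, hf, hdisj.mono_left hB⟩
  · intro A hA B hB
    have h := hcomplete (fun n => if n = 0 then A else B) fun n => by
      by_cases hn : n = 0 <;> simp [hn, hA, hB]
    convert h using 1
    ext M
    simp only [Set.mem_union, Set.mem_iUnion]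
    constructor
    · rintro (hM | hM)
      · exact ⟨0, by simpa using hM⟩
      · exact ⟨1, by simpa using hM⟩
    · rintro ⟨n, hn⟩
      by_cases h0 : n = 0
      · exact Or.inl (by simpa [h0] using hn)
      · exact Or.inr (by simpa [h0] using hn)
  · rintro ⟨-, f, hf, hdisj⟩
    obtain ⟨M, hM, -⟩ := exists_closedSets_superset hf (N := ∅) Set.countable_empty
    exact Set.disjoint_left.1 hdisj hM.1 hM
  · refine ⟨fun M hM => hM.1, fun _ => {x}, fun _ => Set.countable_singleton x,
      Set.disjoint_left.2 ?_⟩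
    rintro M ⟨-, hx⟩ ⟨-, hM⟩
    exact hx (hM [] (by simp) rfl)

lemma isNormal_nonstationary (H : Type*) : IsNormal H (nonstationary H) := by
  intro A hA
  choose hsub f hf hdisj using hA
  refine ⟨fun M hM => hM.1,
    fun l => match l with
      | [] => ∅
      | x :: l => f x l, ?_, Set.disjoint_left.2 ?_⟩
  · rintro (_ | ⟨x, l⟩)
    · exact Set.countable_empty
    · exact hf x l
  · rintro M ⟨hMc, x, hx, hM⟩ ⟨-, hMf⟩
    exact Set.disjoint_left.1 (hdisj x) hM
      ⟨hMc, fun l hl => hMf (x :: l) (List.forall_mem_cons.2 ⟨hx, hl⟩)⟩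

lemma IsIdeal.diff_mem_pos {H : Type*} {I : Set (Set (Set H))} (hI : IsIdeal H I)
    {A X : Set (Set H)} (hA : A ∈ pos H I) (hX : X ∈ I) : A \ X ∈ pos H I := by
  refine ⟨Set.sdiff_subset.trans hA.1, fun h => hA.2 ?_⟩
  refine hI.subset_mem _ (hI.union_mem _ h _ hX) _ fun M hM => ?_
  by_cases hMX : M ∈ X
  · exact Or.inr hMX
  · exact Or.inl ⟨hM, hMX⟩

lemma eIdeal_iff {H : Type*} {I : Set (Set (Set H))} {A : Set (Set H)} (hA : A ⊆ Pom H)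
    {φ : Set H → Prop} : eIdeal I A φ ↔ {M ∈ A | φ M} ∉ I := by
  have hsub : {M ∈ A | φ M} ⊆ Pom H := fun M hM => hA hM.1
  have hinter : {M ∈ A | φ M} ∩ A = {M ∈ A | φ M} := Set.inter_eq_left.2 fun M hM => hM.1
  simp only [eIdeal, pos, add, Set.mem_ofPred_eq, hinter, hsub, true_and]

/-- If `R (F M) (F N)` fails for almost all `M ∈ C` and almost all `N ∈ D`, then normality yields
positive subsets on which it fails whenever `F M ∈ N`. -/
lemma exists_pos_forall_not {H : Type*} {I : Set (Set (Set H))} (hI : IsIdeal H I)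
    (hnormal : IsNormal H I) (F : Set H → H) (R : H → H → Prop) {C D : Set (Set H)}
    (hC : C ∈ pos H I) (hD : D ∈ pos H I)
    (h : ¬ eIdeal I C fun M => eIdeal I D fun N => R (F M) (F N)) :
    ∃ C' ⊆ C, C' ∈ pos H I ∧ ∃ D' ⊆ D, D' ∈ pos H I ∧
      ∀ M ∈ C', ∀ N ∈ D', F M ∈ N → ¬ R (F M) (F N) := by
  rw [eIdeal_iff hC.1, not_not] at h
  let E : H → Set (Set H) := fun x => {N ∈ D | R x (F N) ∧ {N ∈ D | R x (F N)} ∈ I}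
  have hE (x : H) : E x ∈ I := by
    by_cases hx : {N ∈ D | R x (F N)} ∈ I
    · exact hI.subset_mem _ hx _ fun N hN => ⟨hN.1, hN.2.1⟩
    · exact hI.subset_mem _ hI.empty_mem _ fun N hN => hx hN.2.2
  refine ⟨_, Set.sdiff_subset, hI.diff_mem_pos hC h, _, Set.sdiff_subset,
    hI.diff_mem_pos hD (hnormal E hE), fun M hM N hN hMN hR => ?_⟩
  have hsmall : {N ∈ D | R (F M) (F N)} ∈ I := by
    by_contra hpos
    exact hM.2 ⟨hM.1, (eIdeal_iff hD.1).2 hpos⟩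
  exact hN.2 ⟨hD.1 hN.1, F M, hMN, hN.1, hR, hsmall⟩

/-- No pair in `C × D` with `F M ∈ N` has colour `p.1`, or none with `F N ∈ M` has colour `p.2`.
Unlike failure of weak saturation, this does not refer to an ideal. -/
def Omits {H : Type*} {K : ℕ} (c : Sym2 H → Fin K) (F : Set H → H) (C D : Set (Set H))
    (p : Fin K × Fin K) : Prop :=
  (∀ M ∈ C, ∀ N ∈ D, F M ∈ N → ¬ (F M ≠ F N ∧ c s(F M, F N) = p.1)) ∨
    ∀ M ∈ C, ∀ N ∈ D, F N ∈ M → ¬ (F M ≠ F N ∧ c s(F M, F N) = p.2)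

lemma Omits.mono {H : Type*} {K : ℕ} {c : Sym2 H → Fin K} {F : Set H → H}
    {C C' D D' : Set (Set H)} {p : Fin K × Fin K} (h : Omits c F C D p) (hC : C' ⊆ C)
    (hD : D' ⊆ D) : Omits c F C' D' p :=
  h.imp (fun h M hM N hN => h M (hC hM) N (hD hN)) fun h M hM N hN => h M (hC hM) N (hD hN)

lemma exists_pos_omits {H : Type*} {K : ℕ} {c : Sym2 H → Fin K} {F : Set H → H}
    {I : Set (Set (Set H))} (hI : IsIdeal H I) (hnormal : IsNormal H I) {C D : Set (Set H)}
    (hC : C ∈ pos H I) (hD : D ∈ pos H I) {p : Fin K × Fin K}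
    (h : ¬ WeaklySat c I F C D p.1 p.2) :
    ∃ C' ⊆ C, C' ∈ pos H I ∧ ∃ D' ⊆ D, D' ∈ pos H I ∧ Omits c F C' D' p := by
  rcases not_and_or.1 h with h | h
  · obtain ⟨C', hCC', hC', D', hDD', hD', hR⟩ :=
      exists_pos_forall_not hI hnormal F (fun x y => x ≠ y ∧ c s(x, y) = p.1) hC hD h
    exact ⟨C', hCC', hC', D', hDD', hD', Or.inl hR⟩
  · obtain ⟨D', hDD', hD', C', hCC', hC', hR⟩ :=
      exists_pos_forall_not hI hnormal F (fun y x => x ≠ y ∧ c s(x, y) = p.2) hD hC h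
    exact ⟨C', hCC', hC', D', hDD', hD', Or.inr fun M hM N hN => hR N hN M hM⟩

lemma exists_mem_of_mem_pos {H : Type*} {I : Set (Set (Set H))} (hI : IsFineIdeal H I)
    {A : Set (Set H)} (hA : A ∈ pos H I) (x : H) : ∃ M ∈ A, x ∈ M := by
  by_contra! h
  exact hA.2 (hI.1.subset_mem _ (hI.2.2 x) _ fun M hM => ⟨hA.1 hM, h M hM⟩)

lemma nonempty_of_mem_pos {H : Type*} {I : Set (Set (Set H))} (hI : IsIdeal H I)
    {A : Set (Set H)} (hA : A ∈ pos H I) : A.Nonempty :=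
  Set.nonempty_iff_ne_empty.2 fun h => hA.2 (h ▸ hI.empty_mem)

lemma exists_not_omits {H : Type*} {K : ℕ} {c : Sym2 H → Fin K} {F : Set H → H}
    {I : Set (Set (Set H))} (hI : IsFineIdeal H I) {C D : Set (Set H)}
    (hC : C ∈ pos H I) (hD : D ∈ pos H I) (hFC : ∀ M ∈ C, F M ∉ M) (hFD : ∀ N ∈ D, F N ∉ N) :
    ∃ p, ¬ Omits c F C D p := by
  obtain ⟨M, hM⟩ := nonempty_of_mem_pos hI.1 hC
  obtain ⟨N, hN, hMN⟩ := exists_mem_of_mem_pos hI hD (F M)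
  obtain ⟨N', hN'⟩ := nonempty_of_mem_pos hI.1 hD
  obtain ⟨M', hM', hNM⟩ := exists_mem_of_mem_pos hI hC (F N')
  refine ⟨(c s(F M, F N), c s(F M', F N')), ?_⟩
  rintro (h | h)
  · exact h M hM N hN hMN ⟨fun e => hFD N hN (e ▸ hMN), rfl⟩
  · exact h M' hM' N' hN' hNM ⟨fun e => hFC M' hM' (e ▸ hNM), rfl⟩

/-- Lemma 6.8: there are a fine normal ideal `I`, an `I`-positive `A ⊆ Λ`, and `i, j < K`
such that for every fine normal `J ⊇ I` and every `J`-positive `B ⊆ A` there are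
`J`-positive `S, T ⊆ B` with `(S, T)` `(i,j)`-saturated over `I`. -/
theorem first_main_lemma {H : Type u} (K : ℕ) (hK : 0 < K)
    (c : Sym2 H → Fin K)
    (Λ : Set (Set H)) (hΛ : IsStationary H Λ)
    (F : Set H → H) (hF : ∀ M ∈ Λ, F M ∉ M) :
    ∃ I : Set (Set (Set H)), IsFineIdeal H I ∧ IsNormal H I ∧
      ∃ A ⊆ Λ, A ∈ pos H I ∧
        ∃ i j : Fin K,
          ∀ J : Set (Set (Set H)), IsFineIdeal H J → IsNormal H J → I ⊆ J →
            ∀ B, B ⊆ A → B ∈ pos H J →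
              ∃ S, S ⊆ B ∧ S ∈ pos H J ∧ ∃ T, T ⊆ B ∧ T ∈ pos H J ∧
                Sat c I F S T i j := by
  have hns := isFineIdeal_nonstationary H
  by_contra hcon
  have key (P : Finset (Fin K × Fin K)) : ∃ I, IsFineIdeal H I ∧ IsNormal H I ∧
      ∃ A ⊆ Λ, A ∈ pos H I ∧ ∀ S ⊆ A, S ∈ pos H I → ∀ T ⊆ A, T ∈ pos H I →
        ∃ C ⊆ S, C ∈ pos H (nonstationary H) ∧ ∃ D ⊆ T, D ∈ pos H (nonstationary H) ∧
          ∀ p ∈ P, Omits c F C D p := by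
    induction P using Finset.induction_on with
    | empty =>
      exact ⟨_, hns, isNormal_nonstationary H, Λ, subset_rfl, hΛ.mem_pos_nonstationary,
        fun S _ hS T _ hT => ⟨S, subset_rfl, hS, T, subset_rfl, hT, by simp⟩⟩
    | insert p P _ ih =>
      obtain ⟨I, hI, hnormal, A, hAΛ, hA, hIA⟩ := ih
      by_contra hbad
      refine hcon ⟨I, hI, hnormal, A, hAΛ, hA, p.1, p.2, fun J hJ hJn _ B hBA hB => ?_⟩
      by_contra hsat
      refine hbad ⟨J, hJ, hJn, B, hBA.trans hAΛ, hB, fun S hSB hS T hTB hT => ?_⟩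
      have hnot : ¬ Sat c I F S T p.1 p.2 := fun h => hsat ⟨S, hSB, hS, T, hTB, hT, h⟩
      simp only [Sat, not_forall] at hnot
      obtain ⟨C, hCS, hC, D, hDT, hD, hw⟩ := hnot
      obtain ⟨C₁, hC₁C, hC₁, D₁, hD₁D, hD₁, homits⟩ := exists_pos_omits hI.1 hnormal hC hD hw
      have hC₁S := hC₁C.trans hCS
      have hD₁T := hD₁D.trans hDT
      obtain ⟨C₂, hC₂C, hC₂, D₂, hD₂D, hD₂, hP⟩ :=
        hIA C₁ (hC₁S.trans (hSB.trans hBA)) hC₁ D₁ (hD₁T.trans (hTB.trans hBA)) hD₁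
      exact ⟨C₂, hC₂C.trans hC₁S, hC₂, D₂, hD₂D.trans hD₁T, hD₂,
        Finset.forall_mem_insert _ _ _ |>.2 ⟨homits.mono hC₂C hD₂D, hP⟩⟩
  obtain ⟨I, -, -, A, hAΛ, hA, hIA⟩ := key Finset.univ
  obtain ⟨C, hCA, hC, D, hDA, hD, homits⟩ := hIA A subset_rfl hA A subset_rfl hA
  obtain ⟨p, hp⟩ := exists_not_omits (c := c) hns hC hD (fun M hM => hF M (hAΛ (hCA hM)))
    fun N hN => hF N (hAΛ (hDA hN))
  exact hp (homits p (Finset.mem_univ p))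

end Galvin
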